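/- arXiv:math/0205100 — 6 statements merged into one kernel-verified Lean document; each statement's English description precedes it below -/
import Mathlib

section
/- Let V₀, V₁ : ℝ³ → ℝ³ be smooth vector fields and h : ℝ³ → ℝ a smooth function. On ℝ³ × ℝ define T(p,t) = (0,1), V^h(p,t) = (cos(t·h(p))·V₀(p) + sin(t·h(p))·V₁(p), 0), and U^h = [T, V^h]. Then for every (p,t) ∈ ℝ³ × ℝ, the difference [V^h, U^h](p,t) − h(p)·([V₀,V₁](p), 0) lies in the linear span of (V₀(p), 0) and (V₁(p), 0). That is, modulo the horizontal lifts of V₀ and V₁, the bracket [V^h, U^h] equals h·[V₀,V₁]. -/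
/-- Derivative of a horizontal field `(a V₀ + b V₁, 0)`. -/
lemma fderiv_horizontal_apply (V₀ V₁ : (Fin 3 → ℝ) → (Fin 3 → ℝ)) (a b : (Fin 3 → ℝ) × ℝ → ℝ)
    (q w : (Fin 3 → ℝ) × ℝ)
    (hV₀ : DifferentiableAt ℝ V₀ q.1) (hV₁ : DifferentiableAt ℝ V₁ q.1)
    (ha : DifferentiableAt ℝ a q) (hb : DifferentiableAt ℝ b q) :
    fderiv ℝ (fun q : (Fin 3 → ℝ) × ℝ =>
      ((a q • V₀ q.1 + b q • V₁ q.1, 0) : (Fin 3 → ℝ) × ℝ)) q w =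
    ((a q • fderiv ℝ V₀ q.1 w.1 + fderiv ℝ a q w • V₀ q.1) +
      (b q • fderiv ℝ V₁ q.1 w.1 + fderiv ℝ b q w • V₁ q.1), 0) := by
  have h0 : HasFDerivAt (fun q : (Fin 3 → ℝ) × ℝ => V₀ q.1) _ q :=
    hV₀.hasFDerivAt.comp q hasFDerivAt_fst
  have h1 : HasFDerivAt (fun q : (Fin 3 → ℝ) × ℝ => V₁ q.1) _ q :=
    hV₁.hasFDerivAt.comp q hasFDerivAt_fst
  have := ((ha.hasFDerivAt.fun_smul h0).fun_add (hb.hasFDerivAt.fun_smul h1)).prodMk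
    (hasFDerivAt_const (0 : ℝ) q)
  rw [this.fderiv]
  simp

/-- The bracket of two horizontal fields, modulo the span. -/
lemma lieBracket_horizontal (V₀ V₁ : (Fin 3 → ℝ) → (Fin 3 → ℝ))
    (a b c d : (Fin 3 → ℝ) × ℝ → ℝ) (q : (Fin 3 → ℝ) × ℝ)
    (hV₀ : DifferentiableAt ℝ V₀ q.1) (hV₁ : DifferentiableAt ℝ V₁ q.1)
    (ha : DifferentiableAt ℝ a q) (hb : DifferentiableAt ℝ b q)
    (hc : DifferentiableAt ℝ c q) (hd : DifferentiableAt ℝ d q) :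
    VectorField.lieBracket ℝ
      (fun q => ((a q • V₀ q.1 + b q • V₁ q.1, 0) : (Fin 3 → ℝ) × ℝ))
      (fun q => ((c q • V₀ q.1 + d q • V₁ q.1, 0) : (Fin 3 → ℝ) × ℝ)) q
      - (a q * d q - b q * c q) •
        ((VectorField.lieBracket ℝ V₀ V₁ q.1, 0) : (Fin 3 → ℝ) × ℝ) ∈
      Submodule.span ℝ {((V₀ q.1, 0) : (Fin 3 → ℝ) × ℝ), ((V₁ q.1, 0) : (Fin 3 → ℝ) × ℝ)} := by
  rw [VectorField.lieBracket, fderiv_horizontal_apply V₀ V₁ c d q _ hV₀ hV₁ hc hd,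
    fderiv_horizontal_apply V₀ V₁ a b q _ hV₀ hV₁ ha hb, Submodule.mem_span_pair]
  refine ⟨fderiv ℝ c q (a q • V₀ q.1 + b q • V₁ q.1, 0)
      - fderiv ℝ a q (c q • V₀ q.1 + d q • V₁ q.1, 0),
    fderiv ℝ d q (a q • V₀ q.1 + b q • V₁ q.1, 0)
      - fderiv ℝ b q (c q • V₀ q.1 + d q • V₁ q.1, 0), ?_⟩
  ext1
  · simp only [VectorField.lieBracket, map_add, map_smul, Prod.fst_add, Prod.fst_sub,
      Prod.smul_fst]
    module
  · simp

/-- On `ℝ³ × ℝ`, with `T(p,t) = (0,1)`, `V^h(p,t) = (cos(t·h(p))·V₀(p) + sin(t·h(p))·V₁(p), 0)`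
and `U^h = [T, V^h]`, the bracket `[V^h, U^h]` equals `h·[V₀,V₁]` modulo the horizontal lifts
of `V₀` and `V₁`: the difference `[V^h, U^h](p,t) − h(p)·([V₀,V₁](p), 0)` lies in the span of
`(V₀(p), 0)` and `(V₁(p), 0)`. -/
theorem lieBracket_twisted_horizontal
    (V₀ V₁ : (Fin 3 → ℝ) → (Fin 3 → ℝ)) (h : (Fin 3 → ℝ) → ℝ)
    (hV₀ : ContDiff ℝ (⊤ : ℕ∞) V₀) (hV₁ : ContDiff ℝ (⊤ : ℕ∞) V₁) (hh : ContDiff ℝ (⊤ : ℕ∞) h)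
    (T Vh Uh : (Fin 3 → ℝ) × ℝ → (Fin 3 → ℝ) × ℝ)
    (hT : ∀ q, T q = (0, 1))
    (hVh : ∀ q : (Fin 3 → ℝ) × ℝ,
      Vh q = (Real.cos (q.2 * h q.1) • V₀ q.1 + Real.sin (q.2 * h q.1) • V₁ q.1, 0))
    (hUh : Uh = VectorField.lieBracket ℝ T Vh) :
    ∀ p : Fin 3 → ℝ, ∀ t : ℝ,
      VectorField.lieBracket ℝ Vh Uh (p, t)
          - h p • ((VectorField.lieBracket ℝ V₀ V₁ p, 0) : (Fin 3 → ℝ) × ℝ) ∈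
        Submodule.span ℝ {((V₀ p, 0) : (Fin 3 → ℝ) × ℝ), ((V₁ p, 0) : (Fin 3 → ℝ) × ℝ)} := by
  intro p t
  have hT' : T = fun _ => (0, 1) := funext hT
  have hVh' := funext hVh
  have d0 : Differentiable ℝ V₀ := hV₀.differentiable (by simp)
  have d1 : Differentiable ℝ V₁ := hV₁.differentiable (by simp)
  have dh : Differentiable ℝ h := hh.differentiable (by simp)
  have dth : ∀ q : (Fin 3 → ℝ) × ℝ, HasFDerivAt (fun q : (Fin 3 → ℝ) × ℝ => q.2 * h q.1)
      (q.2 • (fderiv ℝ h q.1).comp (ContinuousLinearMap.fst ℝ _ _)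
        + h q.1 • ContinuousLinearMap.snd ℝ _ _) q := fun q =>
    hasFDerivAt_snd.fun_mul ((dh q.1).hasFDerivAt.comp q hasFDerivAt_fst)
  have dhf : Differentiable ℝ (fun q : (Fin 3 → ℝ) × ℝ => h q.1) :=
    dh.comp differentiable_fst
  have dc : Differentiable ℝ (fun q : (Fin 3 → ℝ) × ℝ => Real.cos (q.2 * h q.1)) :=
    fun q => (dth q).cos.differentiableAt
  have ds : Differentiable ℝ (fun q : (Fin 3 → ℝ) × ℝ => Real.sin (q.2 * h q.1)) :=
    fun q => (dth q).sin.differentiableAt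
  have hU : Uh = fun q : (Fin 3 → ℝ) × ℝ =>
      (((-(h q.1 * Real.sin (q.2 * h q.1))) • V₀ q.1
        + (h q.1 * Real.cos (q.2 * h q.1)) • V₁ q.1, 0) : (Fin 3 → ℝ) × ℝ) := by
    funext q
    rw [hUh, VectorField.lieBracket, hT', hVh',
      fderiv_horizontal_apply V₀ V₁ _ _ q _ (d0 _) (d1 _) (dc q) (ds q),
      (dth q).cos.fderiv, (dth q).sin.fderiv]
    ext1
    · simp [mul_comm]
    · simp
  have key := lieBracket_horizontal V₀ V₁ _ _ _ _ (p, t) (d0 p) (d1 p) (dc _) (ds _)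
    ((dhf.fun_mul ds).fun_neg (p, t)) ((dhf.fun_mul dc) (p, t))
  rw [← hVh', ← hU] at key
  convert key using 3
  linear_combination -h p * Real.sin_sq_add_cos_sq (t * h p)
end

section
/- Let V₀, V₁ : ℝ³ → ℝ³ be a framed contact structure on ℝ³ (i.e. V₀(p), V₁(p), [V₀,V₁](p) are linearly independent for every p) and let h : ℝ³ → ℝ be a smooth function with h(p) ≠ 0 for all p. On ℝ³ × ℝ define T(p,t) = (0,1) and V^h(p,t) = (cos(t·h(p))·V₀(p) + sin(t·h(p))·V₁(p), 0). Then for every (p,t) ∈ ℝ³ × ℝ, the four vectors T(p,t), V^h(p,t), [T,V^h](p,t), [V^h,[T,V^h]](p,t) form a basis of ℝ³ × ℝ ≅ ℝ⁴. Hence the distribution spanned by T and V^h is an Engel structure with characteristic foliation given by the vertical lines {p} × ℝ. -/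
lemma engel_aux_deriv
    (V₀ V₁ : (Fin 3 → ℝ) → (Fin 3 → ℝ))
    (hV₀ : Differentiable ℝ V₀) (hV₁ : Differentiable ℝ V₁)
    (a b : (Fin 3 → ℝ) × ℝ → ℝ) (q : (Fin 3 → ℝ) × ℝ) (a' b' : (Fin 3 → ℝ) × ℝ →L[ℝ] ℝ)
    (ha : HasFDerivAt a a' q) (hb : HasFDerivAt b b' q) (v : (Fin 3 → ℝ) × ℝ) :
    fderiv ℝ (fun q : (Fin 3 → ℝ) × ℝ => ((a q • V₀ q.1 + b q • V₁ q.1, 0) : (Fin 3 → ℝ) × ℝ)) q v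
      = (a q • fderiv ℝ V₀ q.1 v.1 + a' v • V₀ q.1
          + (b q • fderiv ℝ V₁ q.1 v.1 + b' v • V₁ q.1), 0) := by
  have h0 : HasFDerivAt (fun q : (Fin 3 → ℝ) × ℝ => V₀ q.1) _ q :=
    HasFDerivAt.comp q (hV₀ q.1).hasFDerivAt hasFDerivAt_fst
  have h1 : HasFDerivAt (fun q : (Fin 3 → ℝ) × ℝ => V₁ q.1) _ q :=
    HasFDerivAt.comp q (hV₁ q.1).hasFDerivAt hasFDerivAt_fst
  have := ((ha.smul h0).add (hb.smul h1)).prodMk (hasFDerivAt_const (0 : ℝ) q)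
  have e := this.fderiv
  simp only [Pi.add_apply, Pi.smul_apply'] at e
  rw [e]
  simp

lemma engel_aux_bracket
    (V₀ V₁ : (Fin 3 → ℝ) → (Fin 3 → ℝ))
    (hV₀ : Differentiable ℝ V₀) (hV₁ : Differentiable ℝ V₁)
    (a b c d : (Fin 3 → ℝ) × ℝ → ℝ) (q : (Fin 3 → ℝ) × ℝ)
    (ha : DifferentiableAt ℝ a q) (hb : DifferentiableAt ℝ b q)
    (hc : DifferentiableAt ℝ c q) (hd : DifferentiableAt ℝ d q) :
    ∃ α β : ℝ, VectorField.lieBracket ℝ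
      (fun q : (Fin 3 → ℝ) × ℝ => ((a q • V₀ q.1 + b q • V₁ q.1, 0) : (Fin 3 → ℝ) × ℝ))
      (fun q : (Fin 3 → ℝ) × ℝ => ((c q • V₀ q.1 + d q • V₁ q.1, 0) : (Fin 3 → ℝ) × ℝ)) q
      = (α • V₀ q.1 + β • V₁ q.1
          + (a q * d q - b q * c q) • VectorField.lieBracket ℝ V₀ V₁ q.1, 0) := by
  refine ⟨fderiv ℝ c q (a q • V₀ q.1 + b q • V₁ q.1, 0)
      - fderiv ℝ a q (c q • V₀ q.1 + d q • V₁ q.1, 0),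
    fderiv ℝ d q (a q • V₀ q.1 + b q • V₁ q.1, 0)
      - fderiv ℝ b q (c q • V₀ q.1 + d q • V₁ q.1, 0), ?_⟩
  rw [VectorField.lieBracket,
    engel_aux_deriv V₀ V₁ hV₀ hV₁ c d q _ _ hc.hasFDerivAt hd.hasFDerivAt,
    engel_aux_deriv V₀ V₁ hV₀ hV₁ a b q _ _ ha.hasFDerivAt hb.hasFDerivAt]
  simp only [Prod.mk_sub_mk, sub_self, VectorField.lieBracket, map_add, map_smul]
  congr 1
  module


/-- Given a framed contact structure `(V₀, V₁)` on `ℝ³` (i.e. `V₀ p`, `V₁ p`, `[V₀,V₁] p`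
are linearly independent at every point) and a nowhere-vanishing smooth function `h`, the
plane field on `ℝ³ × ℝ` spanned by `T(p,t) = (0,1)` and
`V^h(p,t) = (cos(t·h(p))·V₀(p) + sin(t·h(p))·V₁(p), 0)` is an Engel structure: at every
point the four vectors `T`, `V^h`, `[T,V^h]`, `[V^h,[T,V^h]]` form a basis of `ℝ³ × ℝ ≅ ℝ⁴`. -/
theorem twisted_construction_is_engel
    (V₀ V₁ : (Fin 3 → ℝ) → (Fin 3 → ℝ)) (h : (Fin 3 → ℝ) → ℝ)
    (hV₀ : ContDiff ℝ (⊤ : ℕ∞) V₀) (hV₁ : ContDiff ℝ (⊤ : ℕ∞) V₁) (hh : ContDiff ℝ (⊤ : ℕ∞) h)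
    (hframe : ∀ p, LinearIndependent ℝ ![V₀ p, V₁ p, VectorField.lieBracket ℝ V₀ V₁ p])
    (hne : ∀ p, h p ≠ 0)
    (T Vh : (Fin 3 → ℝ) × ℝ → (Fin 3 → ℝ) × ℝ)
    (hT : ∀ q, T q = (0, 1))
    (hVh : ∀ q : (Fin 3 → ℝ) × ℝ,
      Vh q = (Real.cos (q.2 * h q.1) • V₀ q.1 + Real.sin (q.2 * h q.1) • V₁ q.1, 0)) :
    ∀ q : (Fin 3 → ℝ) × ℝ,
      LinearIndependent ℝ
        ![T q, Vh q, VectorField.lieBracket ℝ T Vh q,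
          VectorField.lieBracket ℝ Vh (VectorField.lieBracket ℝ T Vh) q] ∧
      Submodule.span ℝ
        (Set.range
          ![T q, Vh q, VectorField.lieBracket ℝ T Vh q,
            VectorField.lieBracket ℝ Vh (VectorField.lieBracket ℝ T Vh) q]) = ⊤ := by
  have dV₀ : Differentiable ℝ V₀ := hV₀.differentiable (by simp)
  have dV₁ : Differentiable ℝ V₁ := hV₁.differentiable (by simp)
  have dh : Differentiable ℝ h := hh.differentiable (by simp)
  obtain rfl : T = fun _ => (0, 1) := funext hT
  obtain rfl : Vh = fun q : (Fin 3 → ℝ) × ℝ =>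
      ((Real.cos (q.2 * h q.1) • V₀ q.1 + Real.sin (q.2 * h q.1) • V₁ q.1, 0) :
        (Fin 3 → ℝ) × ℝ) := funext hVh
  have hθ : ∀ q : (Fin 3 → ℝ) × ℝ, HasFDerivAt (fun q : (Fin 3 → ℝ) × ℝ => q.2 * h q.1)
      (q.2 • (fderiv ℝ h q.1).comp (ContinuousLinearMap.fst ℝ (Fin 3 → ℝ) ℝ)
        + h q.1 • ContinuousLinearMap.snd ℝ (Fin 3 → ℝ) ℝ) q := fun q =>
    (hasFDerivAt_snd (p := q)).mul (HasFDerivAt.comp q (dh q.1).hasFDerivAt hasFDerivAt_fst)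
  have hW : VectorField.lieBracket ℝ (fun _ : (Fin 3 → ℝ) × ℝ => ((0, 1) : (Fin 3 → ℝ) × ℝ))
      (fun q : (Fin 3 → ℝ) × ℝ =>
      ((Real.cos (q.2 * h q.1) • V₀ q.1 + Real.sin (q.2 * h q.1) • V₁ q.1, 0) :
        (Fin 3 → ℝ) × ℝ)) = fun q : (Fin 3 → ℝ) × ℝ =>
      (((-(h q.1 * Real.sin (q.2 * h q.1))) • V₀ q.1
        + (h q.1 * Real.cos (q.2 * h q.1)) • V₁ q.1, 0) : (Fin 3 → ℝ) × ℝ) := by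
    funext q
    rw [VectorField.lieBracket, engel_aux_deriv V₀ V₁ dV₀ dV₁ _ _ q _ _ (hθ q).cos (hθ q).sin]
    simp [mul_comm]
  intro q
  rw [hW]
  have dθ : DifferentiableAt ℝ (fun q : (Fin 3 → ℝ) × ℝ => q.2 * h q.1) q :=
    (hθ q).differentiableAt
  have dh' : DifferentiableAt ℝ (fun q : (Fin 3 → ℝ) × ℝ => h q.1) q :=
    (dh q.1).comp q differentiableAt_fst
  obtain ⟨α, β, hX⟩ := engel_aux_bracket V₀ V₁ dV₀ dV₁ _ _ _ _ q dθ.cos dθ.sin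
    (dh'.mul dθ.sin).neg (dh'.mul dθ.cos)
  simp only [Pi.neg_apply, Pi.mul_apply] at hX
  refine (fun key => ⟨key, LinearIndependent.span_eq_top_of_card_eq_finrank' key (by simp)⟩) ?_
  erw [hX]
  have cs := Real.sin_sq_add_cos_sq (q.2 * h q.1)
  have hq := hne q.1
  have hf := Fintype.linearIndependent_iff.1 (hframe q.1)
  rw [Fintype.linearIndependent_iff]
  intro g hg
  simp only [Fin.sum_univ_four, Matrix.cons_val] at hg
  have hg1 := congrArg Prod.fst hg
  have hg2 := congrArg Prod.snd hg
  simp only [Prod.fst_add, Prod.snd_add, Prod.smul_fst, Prod.smul_snd, Prod.fst_zero,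
    Prod.snd_zero, smul_zero, zero_add, add_zero, smul_eq_mul, mul_one, mul_zero] at hg1 hg2
  clear hX hg
  generalize Real.cos (q.2 * h q.1) = C at cs hg1
  generalize Real.sin (q.2 * h q.1) = S at cs hg1
  have h3 := hf ![g 1 * C - g 2 * (h q.1 * S) + g 3 * α, g 1 * S + g 2 * (h q.1 * C) + g 3 * β,
    g 3 * (C * (h q.1 * C) - S * -(h q.1 * S))] (by
      simp only [Fin.sum_univ_three, Matrix.cons_val]
      rw [← hg1]
      module)
  have e0 := h3 0
  have e1 := h3 1
  have e2 := h3 2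
  simp only [Matrix.cons_val] at e0 e1 e2
  have g3 : g 3 = 0 := by
    have : g 3 * h q.1 = 0 := by linear_combination e2 - g 3 * h q.1 * cs
    simpa [hq] using this
  rw [g3] at e0 e1
  have g1 : g 1 = 0 := by linear_combination C * e0 + S * e1 - g 1 * cs
  have g2 : g 2 = 0 := by
    have : g 2 * h q.1 = 0 := by linear_combination C * e1 - S * e0 - g 2 * h q.1 * cs
    simpa [hq] using this
  intro i
  fin_cases i
  · exact hg2
  · exact g1
  · exact g2
  · exact g3
end

section
/- Let V₀, V₁ : ℝ³ → ℝ³ be smooth vector fields and h : ℝ³ → ℝ a smooth function. On ℝ³ × ℝ define T(p,t) = (0,1), V^h(p,t) = (cos(t·h(p))·V₀(p) + sin(t·h(p))·V₁(p), 0), and U^h = [T, V^h], and let E(q) = span{T(q), V^h(q), U^h(q)} for q ∈ ℝ³ × ℝ. Then for every smooth vector field Z : ℝ³ × ℝ → ℝ³ × ℝ with Z(q) ∈ E(q) for all q, one has [T, Z](q) ∈ E(q) for all q. In other words, the vertical field ∂/∂t preserves the even-contact distribution 𝒟² of the constructed Engel structure, so ∂/∂t spans its characteristic line field. -/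
theorem lieBracket_vertical {T Z : (Fin 3 → ℝ) × ℝ → (Fin 3 → ℝ) × ℝ}
    (hT : ∀ q, T q = (0, 1)) {q : (Fin 3 → ℝ) × ℝ} (hZ : DifferentiableAt ℝ Z q) :
    HasDerivAt (fun s : ℝ => Z (q.1, s)) (VectorField.lieBracket ℝ T Z q) q.2 := by
  have hT' : T = fun _ => (0, 1) := funext hT
  have h1 : VectorField.lieBracket ℝ T Z q = fderiv ℝ Z q (0, 1) := by
    simp [VectorField.lieBracket, hT']
  rw [h1]
  have h2 : HasDerivAt (fun s : ℝ => (q.1, s)) ((0 : Fin 3 → ℝ), (1 : ℝ)) q.2 :=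
    (hasDerivAt_const q.2 q.1).prodMk (hasDerivAt_id q.2)
  exact HasFDerivAt.comp_hasDerivAt (f := fun s : ℝ => (q.1, s)) q.2 hZ.hasFDerivAt h2

/-- The vertical field `∂/∂t` preserves the even-contact distribution
`E q = span {T q, V^h q, U^h q}` of the twisted Engel structure on `ℝ³ × ℝ`: the bracket of
`T` with any smooth section of `E` remains in `E`, so `∂/∂t` spans the characteristic line
field. -/
theorem twisted_construction_characteristic_line_field
    (V₀ V₁ : (Fin 3 → ℝ) → (Fin 3 → ℝ)) (h : (Fin 3 → ℝ) → ℝ)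
    (hV₀ : ContDiff ℝ (⊤ : ℕ∞) V₀) (hV₁ : ContDiff ℝ (⊤ : ℕ∞) V₁) (hh : ContDiff ℝ (⊤ : ℕ∞) h)
    (T Vh Uh : (Fin 3 → ℝ) × ℝ → (Fin 3 → ℝ) × ℝ)
    (hT : ∀ q, T q = (0, 1))
    (hVh : ∀ q : (Fin 3 → ℝ) × ℝ,
      Vh q = (Real.cos (q.2 * h q.1) • V₀ q.1 + Real.sin (q.2 * h q.1) • V₁ q.1, 0))
    (hUh : Uh = VectorField.lieBracket ℝ T Vh)
    (E : (Fin 3 → ℝ) × ℝ → Submodule ℝ ((Fin 3 → ℝ) × ℝ))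
    (hE : ∀ q, E q = Submodule.span ℝ {T q, Vh q, Uh q}) :
    ∀ Z : (Fin 3 → ℝ) × ℝ → (Fin 3 → ℝ) × ℝ, ContDiff ℝ (⊤ : ℕ∞) Z → (∀ q, Z q ∈ E q) →
      ∀ q, VectorField.lieBracket ℝ T Z q ∈ E q := by
  intro Z hZ hZE q
  have hVd : Differentiable ℝ Vh := by
    have h0 := hV₀.differentiable (by simp)
    have h1 := hV₁.differentiable (by simp)
    have h2 := hh.differentiable (by simp)
    rw [show Vh = _ from funext hVh]
    fun_prop
  have hU : ∀ q, Uh q = (h q.1 • (-Real.sin (q.2 * h q.1) • V₀ q.1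
      + Real.cos (q.2 * h q.1) • V₁ q.1), 0) := by
    intro q
    rw [hUh]
    refine (lieBracket_vertical hT (hVd q)).unique ?_
    simp only [hVh]
    have hm : HasDerivAt (fun s : ℝ => s * h q.1) (h q.1) q.2 := by
      simpa using (hasDerivAt_id q.2).mul_const (h q.1)
    have := ((hm.cos.smul_const (V₀ q.1)).add (hm.sin.smul_const (V₁ q.1))).prodMk
      (hasDerivAt_const q.2 (0 : ℝ))
    refine this.congr_deriv ?_
    congr 1
    module
  have key : ∀ (p : Fin 3 → ℝ) (s t : ℝ), E (p, s) ≤ E (p, t) := by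
    intro p s t
    have hTm : T (p, t) ∈ E (p, t) := by rw [hE]; exact Submodule.subset_span (by simp)
    have hVm : Vh (p, t) ∈ E (p, t) := by rw [hE]; exact Submodule.subset_span (by simp)
    have hUm : Uh (p, t) ∈ E (p, t) := by rw [hE]; exact Submodule.subset_span (by simp)
    have hs : s * h p = (s - t) * h p + t * h p := by ring
    have hd : Real.sin ((s - t) * h p) / h p * h p = Real.sin ((s - t) * h p) := by
      by_cases h0 : h p = 0
      · simp [h0]
      · field_simp
    have eV : Vh (p, s) = Real.cos ((s - t) * h p) • Vh (p, t)
        + (Real.sin ((s - t) * h p) / h p) • Uh (p, t) := by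
      rw [hVh, hVh, hU]
      simp only [hs, Real.cos_add, Real.sin_add, Prod.smul_mk, Prod.mk_add_mk, smul_smul _ (h p), hd]
      congr 1
      · module
      · simp
    have eU : Uh (p, s) = (-(h p * Real.sin ((s - t) * h p))) • Vh (p, t)
        + Real.cos ((s - t) * h p) • Uh (p, t) := by
      rw [hVh, hU, hU]
      simp only [hs, Real.cos_add, Real.sin_add, Prod.smul_mk, Prod.mk_add_mk]
      congr 1
      · module
      · simp
    rw [hE (p, s), Submodule.span_le]
    rintro x (rfl | rfl | rfl)
    · rw [hT (p, s), ← hT (p, t)]; exact hTm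
    · rw [eV]; exact add_mem (Submodule.smul_mem _ _ hVm) (Submodule.smul_mem _ _ hUm)
    · rw [eU]; exact add_mem (Submodule.smul_mem _ _ hVm) (Submodule.smul_mem _ _ hUm)
  have hder := lieBracket_vertical hT (hZ.differentiable (by simp) q)
  rw [← hder.deriv]
  have hcl := range_deriv_subset_closure_span_image (𝕜 := ℝ) (fun s : ℝ => Z (q.1, s))
    (t := Set.univ) dense_univ (Set.mem_range_self q.2)
  have hle : Submodule.span ℝ ((fun s : ℝ => Z (q.1, s)) '' Set.univ) ≤ E q := by
    rw [Submodule.span_le]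
    rintro _ ⟨s, -, rfl⟩
    exact key q.1 s q.2 (hZE _)
  exact closure_minimal hle (Submodule.closed_of_finiteDimensional (E q)) hcl
end

section
/- Let V₀, V₁ : ℝ³ → ℝ³ be smooth vector fields such that V₀(p), V₁(p) are linearly independent for every p, and let h : ℝ³ → ℝ be a smooth function with h(p) ≠ 0 for all p. On ℝ³ × ℝ define T(p,t) = (0,1), V^h(p,t) = (cos(t·h(p))·V₀(p) + sin(t·h(p))·V₁(p), 0), and U^h = [T, V^h]. Then for every (p,t) ∈ ℝ³ × ℝ, the span (as a submodule of ℝ³) of the ℝ³-components of V^h(p,t) and U^h(p,t) equals the span of V₀(p) and V₁(p). That is, projecting the even-contact distribution span{T, V^h, U^h} along the vertical direction recovers the plane field span{V₀, V₁} on every slice ℝ³ × {t}; the deprolongation of the constructed Engel structure is the original contact plane field, independently of the cross section. -/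
/-- Deprolongation recovers the contact plane field: if `V₀ p`, `V₁ p` are linearly
independent everywhere and `h` never vanishes, then on every slice `ℝ³ × {t}` the span of the
`ℝ³`-components of `V^h(p,t)` and `U^h(p,t) = [T,V^h](p,t)` equals the span of `V₀ p` and
`V₁ p`, independently of the cross section. -/
theorem deprolongation_recovers_contact_planes
    (V₀ V₁ : (Fin 3 → ℝ) → (Fin 3 → ℝ)) (h : (Fin 3 → ℝ) → ℝ)
    (hV₀ : ContDiff ℝ (⊤ : ℕ∞) V₀) (hV₁ : ContDiff ℝ (⊤ : ℕ∞) V₁) (hh : ContDiff ℝ (⊤ : ℕ∞) h)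
    (hindep : ∀ p, LinearIndependent ℝ ![V₀ p, V₁ p])
    (hne : ∀ p, h p ≠ 0)
    (T Vh Uh : (Fin 3 → ℝ) × ℝ → (Fin 3 → ℝ) × ℝ)
    (hT : ∀ q, T q = (0, 1))
    (hVh : ∀ q : (Fin 3 → ℝ) × ℝ,
      Vh q = (Real.cos (q.2 * h q.1) • V₀ q.1 + Real.sin (q.2 * h q.1) • V₁ q.1, 0))
    (hUh : Uh = VectorField.lieBracket ℝ T Vh) :
    ∀ p : Fin 3 → ℝ, ∀ t : ℝ,
      Submodule.span ℝ {(Vh (p, t)).1, (Uh (p, t)).1} = Submodule.span ℝ {V₀ p, V₁ p} := by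
  intro p t
  obtain rfl : T = fun _ => (0, 1) := funext hT
  have hVe : Vh = fun q : (Fin 3 → ℝ) × ℝ =>
      (Real.cos (q.2 * h q.1) • V₀ q.1 + Real.sin (q.2 * h q.1) • V₁ q.1, (0 : ℝ)) := funext hVh
  have d0 : Differentiable ℝ V₀ := hV₀.differentiable (by simp)
  have d1 : Differentiable ℝ V₁ := hV₁.differentiable (by simp)
  have dh : Differentiable ℝ h := hh.differentiable (by simp)
  have dV : Differentiable ℝ Vh := by
    rw [hVe]
    fun_prop
  have hcurve : HasDerivAt (fun s : ℝ => (p, s)) ((0 : Fin 3 → ℝ), (1 : ℝ)) t :=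
    (hasDerivAt_const t p).prodMk (hasDerivAt_id t)
  have e1 : HasDerivAt (fun s : ℝ => Vh (p, s)) (fderiv ℝ Vh (p, t) (0, 1)) t :=
    (dV (p, t)).hasFDerivAt.comp_hasDerivAt t hcurve
  have hl : HasDerivAt (fun s : ℝ => s * h p) (h p) t := by
    simpa using (hasDerivAt_id t).mul_const (h p)
  have e2 : HasDerivAt (fun s : ℝ => Vh (p, s))
      (((-Real.sin (t * h p) * h p) • V₀ p + (Real.cos (t * h p) * h p) • V₁ p), 0) t := by
    rw [hVe]
    exact ((hl.cos.smul_const (V₀ p)).add (hl.sin.smul_const (V₁ p))).prodMk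
      (hasDerivAt_const t (0 : ℝ))
  have hU : (Uh (p, t)).1 =
      (-Real.sin (t * h p) * h p) • V₀ p + (Real.cos (t * h p) * h p) • V₁ p := by
    rw [hUh, VectorField.lieBracket_eq]
    simp [e1.unique e2]
  have hV : (Vh (p, t)).1 = Real.cos (t * h p) • V₀ p + Real.sin (t * h p) • V₁ p := by
    rw [hVh]
  rw [hU, hV]
  have hp := hne p
  have hsc := Real.sin_sq_add_cos_sq (t * h p)
  generalize Real.sin (t * h p) = s at *
  generalize Real.cos (t * h p) = c at *
  apply le_antisymm
  · rw [Submodule.span_le]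
    rintro x (rfl | rfl)
    · exact Submodule.mem_span_pair.2 ⟨_, _, rfl⟩
    · exact Submodule.mem_span_pair.2 ⟨_, _, rfl⟩
  · rw [Submodule.span_le]
    rintro x (rfl | rfl)
    · refine Submodule.mem_span_pair.2 ⟨c, -s / h p, ?_⟩
      ext i
      simp only [Pi.add_apply, Pi.smul_apply, smul_eq_mul]
      field_simp
      linear_combination V₀ p i * hsc
    · refine Submodule.mem_span_pair.2 ⟨s, c / h p, ?_⟩
      ext i
      simp only [Pi.add_apply, Pi.smul_apply, smul_eq_mul]
      field_simp
      linear_combination V₁ p i * hsc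
end

section
/- Let V₀, V₁ : ℝ³ → ℝ³ be a framed contact structure on ℝ³ (i.e. V₀(p), V₁(p), [V₀,V₁](p) are linearly independent for every p) and let n ≥ 1 be a natural number. On ℝ³ × ℝ define T(p,θ) = (0,1) and Vₙ(p,θ) = (cos(nθ/2)·V₀(p) + sin(nθ/2)·V₁(p), 0). Then for every (p,θ) ∈ ℝ³ × ℝ the four vectors T(p,θ), Vₙ(p,θ), [T,Vₙ](p,θ), [Vₙ,[T,Vₙ]](p,θ) form a basis of ℝ³ × ℝ ≅ ℝ⁴. Hence the plane field spanned by T and Vₙ, which defines the n-fold prolongation 𝒟ₙ(ξ) of the framed contact structure under the canonical identification ψₙ, is an Engel structure. -/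
/-- Derivative of the horizontal field `(a(θ) V₀(p) + b(θ) V₁(p), 0)`. -/
lemma fderiv_horizontal
    (V₀ V₁ : (Fin 3 → ℝ) → (Fin 3 → ℝ))
    (h₀ : Differentiable ℝ V₀) (h₁ : Differentiable ℝ V₁)
    (a b : ℝ → ℝ) (da db : ℝ) (q : (Fin 3 → ℝ) × ℝ)
    (ha : HasDerivAt a da q.2) (hb : HasDerivAt b db q.2) (v : (Fin 3 → ℝ) × ℝ) :
    fderiv ℝ (fun q : (Fin 3 → ℝ) × ℝ =>
      ((a q.2 • V₀ q.1 + b q.2 • V₁ q.1, 0) : (Fin 3 → ℝ) × ℝ)) q v =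
      (a q.2 • fderiv ℝ V₀ q.1 v.1 + (da * v.2) • V₀ q.1 +
        (b q.2 • fderiv ℝ V₁ q.1 v.1 + (db * v.2) • V₁ q.1), 0) := by
  have H₀ : HasFDerivAt (fun q : (Fin 3 → ℝ) × ℝ => V₀ q.1) _ q :=
    (h₀ q.1).hasFDerivAt.comp q hasFDerivAt_fst
  have H₁ : HasFDerivAt (fun q : (Fin 3 → ℝ) × ℝ => V₁ q.1) _ q :=
    (h₁ q.1).hasFDerivAt.comp q hasFDerivAt_fst
  have A : HasFDerivAt (fun q : (Fin 3 → ℝ) × ℝ => a q.2) _ q :=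
    ha.hasFDerivAt.comp q hasFDerivAt_snd
  have B : HasFDerivAt (fun q : (Fin 3 → ℝ) × ℝ => b q.2) _ q :=
    hb.hasFDerivAt.comp q hasFDerivAt_snd
  have H := ((A.smul H₀).add (B.smul H₁)).prodMk
    (hasFDerivAt_const (0 : ℝ) q)
  refine (congrArg (fun L => L v) H.fderiv).trans ?_
  simp [mul_comm]

/-- The `n`-fold prolongation of a framed contact structure is Engel: given a framed contact
structure `(V₀, V₁)` on `ℝ³` and `n ≥ 1`, the plane field on `ℝ³ × ℝ` spanned by
`T(p,θ) = (0,1)` and `Vₙ(p,θ) = (cos(nθ/2)·V₀(p) + sin(nθ/2)·V₁(p), 0)` satisfies: at every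
point the four vectors `T`, `Vₙ`, `[T,Vₙ]`, `[Vₙ,[T,Vₙ]]` form a basis of `ℝ³ × ℝ ≅ ℝ⁴`. -/
theorem n_fold_prolongation_is_engel
    (V₀ V₁ : (Fin 3 → ℝ) → (Fin 3 → ℝ))
    (hV₀ : ContDiff ℝ (⊤ : ℕ∞) V₀) (hV₁ : ContDiff ℝ (⊤ : ℕ∞) V₁)
    (hframe : ∀ p, LinearIndependent ℝ ![V₀ p, V₁ p, VectorField.lieBracket ℝ V₀ V₁ p])
    (n : ℕ) (hn : 1 ≤ n)
    (T Vn : (Fin 3 → ℝ) × ℝ → (Fin 3 → ℝ) × ℝ)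
    (hT : ∀ q, T q = (0, 1))
    (hVn : ∀ q : (Fin 3 → ℝ) × ℝ,
      Vn q = (Real.cos (n * q.2 / 2) • V₀ q.1 + Real.sin (n * q.2 / 2) • V₁ q.1, 0)) :
    ∀ q : (Fin 3 → ℝ) × ℝ,
      LinearIndependent ℝ
        ![T q, Vn q, VectorField.lieBracket ℝ T Vn q,
          VectorField.lieBracket ℝ Vn (VectorField.lieBracket ℝ T Vn) q] ∧
      Submodule.span ℝ
        (Set.range
          ![T q, Vn q, VectorField.lieBracket ℝ T Vn q,
            VectorField.lieBracket ℝ Vn (VectorField.lieBracket ℝ T Vn) q]) = ⊤ := by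
  have h₀ : Differentiable ℝ V₀ := hV₀.differentiable (by simp)
  have h₁ : Differentiable ℝ V₁ := hV₁.differentiable (by simp)
  have hk : (n : ℝ) / 2 ≠ 0 := by
    have : (n : ℝ) ≠ 0 := by exact_mod_cast (by omega : n ≠ 0)
    positivity
  have hlin : ∀ t : ℝ, HasDerivAt (fun t : ℝ => (n : ℝ) * t / 2) ((n : ℝ) / 2) t := by
    intro t
    simpa using ((hasDerivAt_id t).const_mul (n : ℝ)).div_const 2
  obtain rfl : T = fun _ => (0, 1) := funext hT
  have hVnFun := funext hVn
  have hW : VectorField.lieBracket ℝ (fun _ => ((0, 1) : (Fin 3 → ℝ) × ℝ)) Vn =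
      fun q : (Fin 3 → ℝ) × ℝ =>
        ((-Real.sin (n * q.2 / 2) * ((n : ℝ) / 2)) • V₀ q.1 +
          (Real.cos (n * q.2 / 2) * ((n : ℝ) / 2)) • V₁ q.1, 0) := by
    funext q
    rw [VectorField.lieBracket, hVnFun,
      fderiv_horizontal V₀ V₁ h₀ h₁ (fun t => Real.cos (n * t / 2)) (fun t => Real.sin (n * t / 2))
        _ _ q (hlin q.2).cos (hlin q.2).sin]
    simp
  have hB : ∀ q, VectorField.lieBracket ℝ Vn
      (VectorField.lieBracket ℝ (fun _ => ((0, 1) : (Fin 3 → ℝ) × ℝ)) Vn) q =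
      (((n : ℝ) / 2) • VectorField.lieBracket ℝ V₀ V₁ q.1, 0) := by
    intro q
    rw [hW, VectorField.lieBracket, hVnFun,
      fderiv_horizontal V₀ V₁ h₀ h₁ (fun t => Real.cos (n * t / 2)) (fun t => Real.sin (n * t / 2))
        _ _ q (hlin q.2).cos (hlin q.2).sin,
      fderiv_horizontal V₀ V₁ h₀ h₁ (fun t => -Real.sin (n * t / 2) * ((n : ℝ) / 2))
        (fun t => Real.cos (n * t / 2) * ((n : ℝ) / 2))
        _ _ q ((hlin q.2).sin.neg.mul_const _) ((hlin q.2).cos.mul_const _)]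
    have hcs := Real.sin_sq_add_cos_sq (n * q.2 / 2)
    ext i
    · simp only [VectorField.lieBracket, map_add, map_smul, Prod.fst_sub, Pi.sub_apply,
        Pi.add_apply, Pi.smul_apply, smul_eq_mul, mul_zero, zero_mul, add_zero]
      linear_combination ((n : ℝ) / 2) * (fderiv ℝ V₁ q.1 (V₀ q.1) i -
        fderiv ℝ V₀ q.1 (V₁ q.1) i) * hcs
    · simp
  intro q
  have key : LinearIndependent ℝ
        ![(0, 1), Vn q, VectorField.lieBracket ℝ (fun _ => ((0, 1) : (Fin 3 → ℝ) × ℝ)) Vn q,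
          VectorField.lieBracket ℝ Vn
            (VectorField.lieBracket ℝ (fun _ => ((0, 1) : (Fin 3 → ℝ) × ℝ)) Vn) q] := by
    rw [hB, hW, hVn]
    beta_reduce
    have hf := hframe q.1
    have hcs := Real.sin_sq_add_cos_sq (n * q.2 / 2)
    generalize VectorField.lieBracket ℝ V₀ V₁ q.1 = L at *
    generalize Real.sin (n * q.2 / 2) = s at *
    generalize Real.cos (n * q.2 / 2) = c at *
    generalize (n : ℝ) / 2 = k at *
    rw [Fintype.linearIndependent_iff] at hf ⊢
    intro g hg
    simp only [Fin.sum_univ_four, Matrix.cons_val] at hg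
    have hg2 := congrArg Prod.snd hg
    have hg1 := congrArg Prod.fst hg
    simp at hg2
    simp only [Prod.fst_add, Prod.smul_fst, Prod.fst_zero, smul_zero, zero_add] at hg1
    have h := hf ![g 1 * c - g 2 * (s * k), g 1 * s + g 2 * (c * k), g 3 * k] (by
      simp only [Fin.sum_univ_three, Matrix.cons_val]
      rw [← hg1]
      module)
    have e0 := h 0
    have e1 := h 1
    have e2 := h 2
    simp only [Matrix.cons_val] at e0 e1 e2
    have g3 : g 3 = 0 := (mul_eq_zero.mp e2).resolve_right hk
    have g1 : g 1 = 0 := by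
      linear_combination c * e0 + s * e1 - g 1 * hcs
    have g2k : g 2 * k = 0 := by
      linear_combination c * e1 - s * e0 - g 2 * k * hcs
    have g2 : g 2 = 0 := (mul_eq_zero.mp g2k).resolve_right hk
    intro i
    fin_cases i
    · exact hg2
    · exact g1
    · exact g2
    · exact g3
  exact ⟨key, key.span_eq_top_of_card_eq_finrank (by simp)⟩
end

section
/- Let W : ℝ³ × ℝ → ℝ³ be a smooth map, and on ℝ³ × ℝ define the vector fields T(p,t) = (0,1) and Ŵ(p,t) = (W(p,t), 0). Assume that for every q ∈ ℝ³ × ℝ the four vectors T(q), Ŵ(q), [T,Ŵ](q), [Ŵ,[T,Ŵ]](q) form a basis of ℝ³ × ℝ (i.e. span{T, Ŵ} is an Engel structure with vertical characteristic line field). Let W'(p,t) denote the ℝ³-component of [T,Ŵ](p,t). Then for every fixed t ∈ ℝ and every p ∈ ℝ³, the three vectors W(p,t), W'(p,t), and [W(·,t), W'(·,t)](p) (the Lie bracket on ℝ³ of the slice fields) are linearly independent in ℝ³. That is, the plane field span{W(·,t), W'(·,t)} induced on each slice ℝ³ × {t} by the even-contact distribution is a contact structure: deprolongation of an Engel structure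 yields a contact structure on any cross section transverse to the characteristic foliation. -/
/-- The derivative of a horizontal field on the product. -/
lemma hasFDerivAt_horizontal {E : Type*} [NormedAddCommGroup E] [NormedSpace ℝ E]
    {A : E × ℝ → E} {q : E × ℝ} (hA : DifferentiableAt ℝ A q) :
    fderiv ℝ (fun q => (A q, (0 : ℝ))) q = (fderiv ℝ A q).prod 0 :=
  (hA.hasFDerivAt.prodMk (hasFDerivAt_const (0 : ℝ) q)).fderiv

/-- The derivative of a slice. -/
lemma fderiv_slice {E : Type*} [NormedAddCommGroup E] [NormedSpace ℝ E]
    {A : E × ℝ → E} {p : E} {t : ℝ} (hA : DifferentiableAt ℝ A (p, t)) (v : E) :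
    fderiv ℝ (fun x => A (x, t)) p v = fderiv ℝ A (p, t) (v, 0) := by
  have hg : HasFDerivAt (fun x : E => (x, t)) ((ContinuousLinearMap.id ℝ E).prod 0) p :=
    (hasFDerivAt_id p).prodMk (hasFDerivAt_const t p)
  have h := HasFDerivAt.comp (g := A) (f := fun x : E => (x, t)) p hA.hasFDerivAt hg
  have h' : fderiv ℝ (fun x => A (x, t)) p = _ := h.fderiv
  rw [h']
  simp

/-- The bracket of horizontal fields is the slice bracket. -/
lemma lieBracket_horizontal_s12 {E : Type*} [NormedAddCommGroup E] [NormedSpace ℝ E]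
    {A B : E × ℝ → E} {p : E} {t : ℝ} (hA : DifferentiableAt ℝ A (p, t))
    (hB : DifferentiableAt ℝ B (p, t)) :
    VectorField.lieBracket ℝ (fun q => (A q, (0 : ℝ))) (fun q => (B q, (0 : ℝ))) (p, t) =
      (VectorField.lieBracket ℝ (fun x => A (x, t)) (fun x => B (x, t)) p, 0) := by
  simp only [VectorField.lieBracket, hasFDerivAt_horizontal hA, hasFDerivAt_horizontal hB,
    fderiv_slice hA, fderiv_slice hB]
  simp

/-- Deprolongation of an Engel structure yields a contact structure on every cross section
transverse to the characteristic foliation: if `T(p,t) = (0,1)` and `Ŵ(p,t) = (W(p,t), 0)`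
span an Engel structure on `ℝ³ × ℝ` (in the sense that `T`, `Ŵ`, `[T,Ŵ]`, `[Ŵ,[T,Ŵ]]` form a
basis at every point), and `W'` is the `ℝ³`-component of `[T,Ŵ]`, then on each slice
`ℝ³ × {t}` the vectors `W(p,t)`, `W'(p,t)`, `[W(·,t), W'(·,t)](p)` are linearly independent. -/
theorem deprolongation_is_contact
    (W : (Fin 3 → ℝ) × ℝ → (Fin 3 → ℝ)) (hW : ContDiff ℝ (⊤ : ℕ∞) W)
    (T What : (Fin 3 → ℝ) × ℝ → (Fin 3 → ℝ) × ℝ)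
    (hT : ∀ q, T q = (0, 1))
    (hWhat : ∀ q, What q = (W q, 0))
    (hEngel : ∀ q : (Fin 3 → ℝ) × ℝ,
      LinearIndependent ℝ
        ![T q, What q, VectorField.lieBracket ℝ T What q,
          VectorField.lieBracket ℝ What (VectorField.lieBracket ℝ T What) q] ∧
      Submodule.span ℝ
        (Set.range
          ![T q, What q, VectorField.lieBracket ℝ T What q,
            VectorField.lieBracket ℝ What (VectorField.lieBracket ℝ T What) q]) = ⊤)
    (W' : (Fin 3 → ℝ) × ℝ → (Fin 3 → ℝ))
    (hW' : ∀ q, W' q = (VectorField.lieBracket ℝ T What q).1) :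
    ∀ t : ℝ, ∀ p : Fin 3 → ℝ,
      LinearIndependent ℝ
        ![W (p, t), W' (p, t),
          VectorField.lieBracket ℝ (fun x => W (x, t)) (fun x => W' (x, t)) p] := by
  intro t p
  have hd : Differentiable ℝ W := hW.differentiable (by simp)
  obtain rfl : T = fun _ => (0, 1) := funext hT
  obtain rfl : What = fun q => (W q, 0) := funext hWhat
  have hbr : ∀ q, VectorField.lieBracket ℝ (fun _ => ((0, 1) : (Fin 3 → ℝ) × ℝ))
      (fun q => (W q, 0)) q = (fderiv ℝ W q (0, 1), 0) := by
    intro q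
    simp [VectorField.lieBracket, hasFDerivAt_horizontal (hd q)]
  obtain rfl : W' = fun q => fderiv ℝ W q (0, 1) := by
    funext q
    rw [hW', hbr]
  have hd' : Differentiable ℝ (fun q => fderiv ℝ W q (0, 1)) := by
    have h1 : ContDiff ℝ 1 (fderiv ℝ W) :=
      (hW.of_le (m := 2) (WithTop.coe_le_coe.2 (le_top : (2 : ℕ∞) ≤ ⊤))).fderiv_right
        (by norm_num)
    exact (h1.differentiable (by simp)).clm_apply (differentiable_const _)
  have h := (hEngel (p, t)).1
  rw [funext hbr, lieBracket_horizontal_s12 (hd _) (hd' _)] at h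
  have h2 := h.comp Fin.succ (Fin.succ_injective 3)
  refine LinearIndependent.of_comp (LinearMap.inl ℝ (Fin 3 → ℝ) ℝ) ?_
  convert h2 using 1
  funext i
  fin_cases i <;> rfl
end
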